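/- arXiv:1705.00596 — 6 statements merged into one kernel-verified Lean document; each statement's English description precedes it below -/
import Mathlib

section
/- Let V : ℝ → ℝ be concave on [0,1] and let q₁, q₀ be positive reals. Then the function f(π) = (π·q₁ + (1−π)·q₀) · V(π·q₁ / (π·q₁ + (1−π)·q₀)) is concave on [0,1]. -/
/-- Jensen's inequality for two points with unnormalized weights. -/
theorem ConcaveOn.add_mul_le_mul_div {s : Set ℝ} {V : ℝ → ℝ} (hV : ConcaveOn ℝ s V)
    {x y p r : ℝ} (hx : x ∈ s) (hy : y ∈ s) (hp : 0 ≤ p) (hr : 0 ≤ r) (hpr : 0 < p + r) :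
    p * V x + r * V y ≤ (p + r) * V ((p * x + r * y) / (p + r)) := by
  have h := hV.2 hx hy (div_nonneg hp hpr.le) (div_nonneg hr hpr.le)
    (by rw [← add_div, div_self hpr.ne'])
  simp only [smul_eq_mul] at h
  have e : p / (p + r) * x + r / (p + r) * y = (p * x + r * y) / (p + r) := by ring
  rw [e] at h
  calc p * V x + r * V y
      = (p + r) * (p / (p + r) * V x + r / (p + r) * V y) := by field_simp
    _ ≤ _ := mul_le_mul_of_nonneg_left h hpr.le

/-- If `V` is concave on `[0,1]` and `q₁, q₀ > 0`, then
`π ↦ (π·q₁ + (1−π)·q₀) · V (π·q₁ / (π·q₁ + (1−π)·q₀))` is concave on `[0,1]`. -/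
theorem stmt0 (V : ℝ → ℝ) (hV : ConcaveOn ℝ (Set.Icc (0:ℝ) 1) V)
    (q₁ q₀ : ℝ) (hq₁ : 0 < q₁) (hq₀ : 0 < q₀) :
    ConcaveOn ℝ (Set.Icc (0:ℝ) 1)
      (fun π : ℝ => (π * q₁ + (1 - π) * q₀) * V (π * q₁ / (π * q₁ + (1 - π) * q₀))) := by
  have hw : ∀ x ∈ Set.Icc (0:ℝ) 1, 0 < x * q₁ + (1 - x) * q₀ := by
    rintro x ⟨h0, h1⟩
    rcases h0.eq_or_lt with rfl | h0
    · simpa using hq₀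
    · exact add_pos_of_pos_of_nonneg (mul_pos h0 hq₁) (mul_nonneg (sub_nonneg.2 h1) hq₀.le)
  have hm : ∀ x ∈ Set.Icc (0:ℝ) 1,
      x * q₁ / (x * q₁ + (1 - x) * q₀) ∈ Set.Icc (0:ℝ) 1 := by
    intro x hx
    refine ⟨div_nonneg (mul_nonneg hx.1 hq₁.le) (hw x hx).le, (div_le_one (hw x hx)).2 ?_⟩
    exact le_add_of_nonneg_right (mul_nonneg (sub_nonneg.2 hx.2) hq₀.le)
  refine ⟨convex_Icc 0 1, fun x hx y hy a b ha hb hab => ?_⟩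
  have hpos := hw _ (convex_Icc (0:ℝ) 1 hx hy ha hb hab)
  simp only [smul_eq_mul] at hpos ⊢
  have hsum : (a * x + b * y) * q₁ + (1 - (a * x + b * y)) * q₀
      = a * (x * q₁ + (1 - x) * q₀) + b * (y * q₁ + (1 - y) * q₀) := by
    linear_combination (-q₀) * hab
  have hnum : (a * x + b * y) * q₁
      = a * (x * q₁ + (1 - x) * q₀) * (x * q₁ / (x * q₁ + (1 - x) * q₀))
        + b * (y * q₁ + (1 - y) * q₀) * (y * q₁ / (y * q₁ + (1 - y) * q₀)) := by
    rw [mul_assoc a, mul_assoc b, mul_div_cancel₀ _ (hw x hx).ne',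
      mul_div_cancel₀ _ (hw y hy).ne']
    ring
  rw [hsum] at hpos ⊢
  rw [hnum, ← mul_assoc a, ← mul_assoc b]
  exact hV.add_mul_le_mul_div (hm x hx) (hm y hy) (mul_nonneg ha (hw x hx).le)
    (mul_nonneg hb (hw y hy).le) hpos
end

section
/- If V : ℝ → ℝ is concave on [0,1], then the expected next-stage value function π ↦ ∑_{y∈𝒴} m(y,π)·V(u(y,π)) is concave on [0,1]. (Lemma 2 of the paper.) -/
/-- The perspective `(x, m) ↦ m * V (x / m)` of a concave function is superadditive. -/
theorem ConcaveOn.add_perspective_le {s : Set ℝ} {V : ℝ → ℝ} (hV : ConcaveOn ℝ s V)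
    {x₁ x₂ m₁ m₂ a b : ℝ} (hm₁ : 0 < m₁) (hm₂ : 0 < m₂) (hx₁ : x₁ / m₁ ∈ s) (hx₂ : x₂ / m₂ ∈ s)
    (ha : 0 ≤ a) (hb : 0 ≤ b) (hm : 0 < a * m₁ + b * m₂) :
    a * (m₁ * V (x₁ / m₁)) + b * (m₂ * V (x₂ / m₂)) ≤
      (a * m₁ + b * m₂) * V ((a * x₁ + b * x₂) / (a * m₁ + b * m₂)) := by
  have ha' : 0 ≤ a * m₁ / (a * m₁ + b * m₂) := by positivity
  have hb' : 0 ≤ b * m₂ / (a * m₁ + b * m₂) := by positivity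
  have key := hV.2 hx₁ hx₂ ha' hb' (by rw [← add_div, div_self hm.ne'])
  have hx : a * m₁ / (a * m₁ + b * m₂) * (x₁ / m₁) + b * m₂ / (a * m₁ + b * m₂) * (x₂ / m₂) =
      (a * x₁ + b * x₂) / (a * m₁ + b * m₂) := by
    field_simp
  simp only [smul_eq_mul] at key
  rw [hx] at key
  calc a * (m₁ * V (x₁ / m₁)) + b * (m₂ * V (x₂ / m₂))
      = (a * m₁ + b * m₂) * (a * m₁ / (a * m₁ + b * m₂) * V (x₁ / m₁) +
          b * m₂ / (a * m₁ + b * m₂) * V (x₂ / m₂)) := by field_simp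
    _ ≤ _ := mul_le_mul_of_nonneg_left key hm.le

/-- A convex combination of two positive reals with a weight in `[0,1]` is positive. -/
theorem evidence_pos {p q t : ℝ} (hp : 0 < p) (hq : 0 < q) (ht : t ∈ Set.Icc (0:ℝ) 1) :
    0 < t * p + (1 - t) * q := by
  simpa using convex_Ioi (0:ℝ) hp hq ht.1 (sub_nonneg.2 ht.2) (add_sub_cancel t 1)

theorem posterior_mem_Icc {p q t : ℝ} (hp : 0 < p) (hq : 0 < q) (ht : t ∈ Set.Icc (0:ℝ) 1) :
    t * p / (t * p + (1 - t) * q) ∈ Set.Icc (0:ℝ) 1 := by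
  have hm := evidence_pos hp hq ht
  refine ⟨div_nonneg (mul_nonneg ht.1 hp.le) hm.le, (div_le_one hm).2 ?_⟩
  exact le_add_of_nonneg_right (mul_nonneg (sub_nonneg.2 ht.2) hq.le)

/-- Lemma 2 of the paper: concavity preservation under Bayesian updating:
if `V` is concave on `[0,1]`, the expected next-stage value function
`π ↦ ∑ y, m(y,π)·V(u(y,π))` is concave on `[0,1]`. -/
theorem stmt1 {𝒴 : Type*} [Fintype 𝒴] [Nonempty 𝒴]
    (p₁ p₀ : 𝒴 → ℝ) (hp₁ : ∀ y, 0 < p₁ y) (hp₀ : ∀ y, 0 < p₀ y)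
    (hs₁ : ∑ y, p₁ y = 1) (hs₀ : ∑ y, p₀ y = 1)
    (V : ℝ → ℝ) (hV : ConcaveOn ℝ (Set.Icc (0:ℝ) 1) V) :
    ConcaveOn ℝ (Set.Icc (0:ℝ) 1)
      (fun π : ℝ => ∑ y, (π * p₁ y + (1 - π) * p₀ y) *
        V (π * p₁ y / (π * p₁ y + (1 - π) * p₀ y))) := by
  refine ⟨convex_Icc 0 1, fun s hs t ht a b ha hb hab => ?_⟩
  simp only [smul_eq_mul, Finset.mul_sum, ← Finset.sum_add_distrib]
  refine Finset.sum_le_sum fun y _ => ?_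
  have hm : (a * s + b * t) * p₁ y + (1 - (a * s + b * t)) * p₀ y =
      a * (s * p₁ y + (1 - s) * p₀ y) + b * (t * p₁ y + (1 - t) * p₀ y) := by
    linear_combination (-p₀ y) * hab
  have hx : (a * s + b * t) * p₁ y = a * (s * p₁ y) + b * (t * p₁ y) := by ring
  have hpos := evidence_pos (hp₁ y) (hp₀ y) (convex_Icc (0:ℝ) 1 hs ht ha hb hab)
  simp only [smul_eq_mul] at hpos
  rw [hm] at hpos ⊢
  rw [hx]
  exact hV.add_perspective_le (evidence_pos (hp₁ y) (hp₀ y) hs) (evidence_pos (hp₁ y) (hp₀ y) ht)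
    (posterior_mem_Icc (hp₁ y) (hp₀ y) hs) (posterior_mem_Icc (hp₁ y) (hp₀ y) ht) ha hb hpos
end

section
/- If V : ℝ → ℝ is concave on [0,1], then for any real constants C and d, the function W(π) = min(C·π, d + ∑_{y∈𝒴} m(y,π)·V(u(y,π))) is concave on [0,1]. (The induction step of the paper's Lemma 1: one backward step of the value recursion (12) preserves concavity.) -/
/-- The evidence-weighted posterior value of a concave function is concave in the prior. -/
theorem ConcaveOn.evidence_mul_posterior {V : ℝ → ℝ} (hV : ConcaveOn ℝ (Set.Icc (0:ℝ) 1) V)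
    {a b : ℝ} (ha : 0 < a) (hb : 0 < b) :
    ConcaveOn ℝ (Set.Icc (0:ℝ) 1)
      (fun π : ℝ => (π * a + (1 - π) * b) * V (π * a / (π * a + (1 - π) * b))) := by
  have m_pos : ∀ π ∈ Set.Icc (0:ℝ) 1, 0 < π * a + (1 - π) * b := by
    rintro π ⟨h0, h1⟩
    rcases h0.eq_or_lt with rfl | h0
    · simpa using hb
    · have := mul_pos h0 ha
      have := mul_nonneg (sub_nonneg.2 h1) hb.le
      linarith
  have u_mem : ∀ π ∈ Set.Icc (0:ℝ) 1,
      π * a / (π * a + (1 - π) * b) ∈ Set.Icc (0:ℝ) 1 := by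
    intro π hπ
    have hm := m_pos π hπ
    refine ⟨div_nonneg (mul_nonneg hπ.1 ha.le) hm.le, (div_le_one hm).2 ?_⟩
    have := mul_nonneg (sub_nonneg.2 hπ.2) hb.le
    linarith
  refine ⟨convex_Icc 0 1, fun x hx z hz s t hs ht hst => ?_⟩
  have hw := m_pos _ (convex_Icc (0:ℝ) 1 hx hz hs ht hst)
  have hmx := m_pos x hx
  have hmz := m_pos z hz
  have hux := u_mem x hx
  have huz := u_mem z hz
  simp only [smul_eq_mul] at hw ⊢
  have hm : (s * x + t * z) * a + (1 - (s * x + t * z)) * b =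
      s * (x * a + (1 - x) * b) + t * (z * a + (1 - z) * b) := by
    linear_combination (-b) * hst
  rw [hm] at hw ⊢
  have hnum : (s * x + t * z) * a = s * (x * a) + t * (z * a) := by ring
  rw [hnum]
  generalize x * a + (1 - x) * b = mx at *
  generalize z * a + (1 - z) * b = mz at *
  have hα : 0 ≤ s * mx / (s * mx + t * mz) := by positivity
  have hβ : 0 ≤ t * mz / (s * mx + t * mz) := by positivity
  have hαβ : s * mx / (s * mx + t * mz) + t * mz / (s * mx + t * mz) = 1 := by
    rw [← add_div, div_self hw.ne']
  have key := hV.2 hux huz hα hβ hαβ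
  simp only [smul_eq_mul] at key
  have harg : s * mx / (s * mx + t * mz) * (x * a / mx) +
      t * mz / (s * mx + t * mz) * (z * a / mz) =
      (s * (x * a) + t * (z * a)) / (s * mx + t * mz) := by
    field_simp
  rw [harg] at key
  calc s * (mx * V (x * a / mx)) + t * (mz * V (z * a / mz))
      = (s * mx + t * mz) * (s * mx / (s * mx + t * mz) * V (x * a / mx) +
          t * mz / (s * mx + t * mz) * V (z * a / mz)) := by
        field_simp
    _ ≤ _ := mul_le_mul_of_nonneg_left key hw.le


/-- induction step of the paper's Lemma 1: one backward step of the value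
recursion preserves concavity: if `V` is concave on `[0,1]`, then
`W(π) = min (C·π) (d + ∑ y, m(y,π)·V(u(y,π)))` is concave on `[0,1]`. -/
theorem stmt2 {𝒴 : Type*} [Fintype 𝒴] [Nonempty 𝒴]
    (p₁ p₀ : 𝒴 → ℝ) (hp₁ : ∀ y, 0 < p₁ y) (hp₀ : ∀ y, 0 < p₀ y)
    (hs₁ : ∑ y, p₁ y = 1) (hs₀ : ∑ y, p₀ y = 1)
    (V : ℝ → ℝ) (hV : ConcaveOn ℝ (Set.Icc (0:ℝ) 1) V)
    (C d : ℝ) :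
    ConcaveOn ℝ (Set.Icc (0:ℝ) 1)
      (fun π : ℝ => min (C * π)
        (d + ∑ y, (π * p₁ y + (1 - π) * p₀ y) *
          V (π * p₁ y / (π * p₁ y + (1 - π) * p₀ y)))) := by
  refine ConcaveOn.inf ((LinearMap.mulLeft ℝ C).concaveOn (convex_Icc 0 1)) ?_
  refine (concaveOn_const d (convex_Icc 0 1)).add ⟨convex_Icc 0 1, ?_⟩
  intro x hx z hz s t hs ht hst
  simp only [Finset.smul_sum, ← Finset.sum_add_distrib]
  exact Finset.sum_le_sum fun y _ =>
    (hV.evidence_mul_posterior (hp₁ y) (hp₀ y)).2 hx hz hs ht hst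
end

section
/- Every value function V_i of the backward recursion, i = 1,…,K, is concave on [0,1]. (Lemma 1 of the paper.) -/
/-- The perspective of a concave function along a positive two-point mixture: if `f` is concave on
`[0,1]`, then so is the mixture weight times `f` evaluated at the posterior probability. -/
theorem ConcaveOn.mixture_mul_posterior {f : ℝ → ℝ} (hf : ConcaveOn ℝ (Set.Icc (0 : ℝ) 1) f)
    {p q : ℝ} (hp : 0 < p) (hq : 0 < q) :
    ConcaveOn ℝ (Set.Icc (0 : ℝ) 1)
      fun x => (x * p + (1 - x) * q) * f (x * p / (x * p + (1 - x) * q)) := by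
  have hm : ∀ x ∈ Set.Icc (0 : ℝ) 1, 0 < x * p + (1 - x) * q := by
    rintro x ⟨hx0, hx1⟩
    rcases hx0.eq_or_lt with rfl | hx
    · simpa using hq
    · have := mul_nonneg (sub_nonneg.2 hx1) hq.le
      positivity
  have hu : ∀ x ∈ Set.Icc (0 : ℝ) 1, x * p / (x * p + (1 - x) * q) ∈ Set.Icc (0 : ℝ) 1 := by
    intro x hx
    refine ⟨div_nonneg (mul_nonneg hx.1 hp.le) (hm x hx).le, (div_le_one (hm x hx)).2 ?_⟩
    exact le_add_of_nonneg_right (mul_nonneg (sub_nonneg.2 hx.2) hq.le)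
  refine ⟨convex_Icc 0 1, fun x hx y hy a b ha hb hab => ?_⟩
  have hz := hm _ (convex_Icc (0 : ℝ) 1 hx hy ha hb hab)
  have hmx := hm x hx
  have hmy := hm y hy
  have hux := hu x hx
  have huy := hu y hy
  simp only [smul_eq_mul] at hz ⊢
  have hsplit : (a * x + b * y) * p + (1 - (a * x + b * y)) * q =
      a * (x * p + (1 - x) * q) + b * (y * p + (1 - y) * q) := by
    linear_combination (-q) * hab
  rw [hsplit] at hz ⊢
  set m := x * p + (1 - x) * q
  set n := y * p + (1 - y) * q
  have key := hf.2 hux huy (div_nonneg (mul_nonneg ha hmx.le) hz.le)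
    (div_nonneg (mul_nonneg hb hmy.le) hz.le) (by rw [← add_div, div_self hz.ne'])
  simp only [smul_eq_mul] at key
  have hpost : a * m / (a * m + b * n) * (x * p / m) + b * n / (a * m + b * n) * (y * p / n) =
      (a * x + b * y) * p / (a * m + b * n) := by
    have := hz.ne'
    field_simp
  rw [hpost] at key
  refine le_of_eq_of_le ?_ (mul_le_mul_of_nonneg_left key hz.le)
  have := hz.ne'
  field_simp

/-- A finite sum of concave functions is concave. -/
theorem concaveOn_finset_sum {ι : Type*} {s : Set ℝ} (hs : Convex ℝ s) (t : Finset ι)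
    {f : ι → ℝ → ℝ} (hf : ∀ i ∈ t, ConcaveOn ℝ s (f i)) :
    ConcaveOn ℝ s fun x => ∑ i ∈ t, f i x := by
  refine ⟨hs, fun x hx y hy a b ha hb hab => ?_⟩
  simp only [Finset.smul_sum, ← Finset.sum_add_distrib]
  exact Finset.sum_le_sum fun i hi => (hf i hi).2 hx hy ha hb hab

/-- A real function of the form `x ↦ a * x + b` is concave on the unit interval. -/
theorem concaveOn_Icc_mul_add (a b : ℝ) :
    ConcaveOn ℝ (Set.Icc (0 : ℝ) 1) fun x => a * x + b := by
  refine ⟨convex_Icc 0 1, fun x _ y _ s t _ _ hst => le_of_eq ?_⟩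
  simp only [smul_eq_mul]
  linear_combination b * hst


/-- Lemma 1 of the paper: every value function `V i`, `i = 1,…,K`, of the
backward recursion (Eq. (12)) is concave on `[0,1]`. -/
theorem stmt3 (K : ℕ) (hK : 1 ≤ K)
    (𝒴 : ℕ → Type) [∀ i, Fintype (𝒴 i)] [∀ i, Nonempty (𝒴 i)]
    (p1 p0 : ∀ i, 𝒴 i → ℝ)
    (hp1 : ∀ i y, 0 < p1 i y) (hp0 : ∀ i y, 0 < p0 i y)
    (hs1 : ∀ i, ∑ y, p1 i y = 1) (hs0 : ∀ i, ∑ y, p0 i y = 1)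
    (C_M C_A : ℝ) (hCM : 0 ≤ C_M) (hCA : 0 ≤ C_A)
    (d : ℕ → ℝ) (hd : ∀ i, 0 ≤ d i)
    (V : ℕ → ℝ → ℝ)
    (hVK : ∀ π : ℝ, V K π = min (C_M * π) (C_A * (1 - π)))
    (hVi : ∀ i, 1 ≤ i → i < K → ∀ π : ℝ,
      V i π = min (C_M * π) (d (i+1) + ∑ y : 𝒴 (i+1),
        (π * p1 (i+1) y + (1 - π) * p0 (i+1) y) *
          V (i+1) (π * p1 (i+1) y / (π * p1 (i+1) y + (1 - π) * p0 (i+1) y)))) :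
    ∀ i, 1 ≤ i → i ≤ K → ConcaveOn ℝ (Set.Icc (0:ℝ) 1) (V i) := by
  have hlin : ConcaveOn ℝ (Set.Icc (0 : ℝ) 1) fun x => C_M * x := by
    simpa using concaveOn_Icc_mul_add C_M 0
  intro i hi hiK
  induction hiK using Nat.decreasingInduction with
  | self =>
    rw [show V K = (fun x => C_M * x) ⊓ fun x => -C_A * x + C_A by
      funext x
      rw [hVK, show C_A * (1 - x) = -C_A * x + C_A by ring]
      rfl]
    exact hlin.inf (concaveOn_Icc_mul_add _ _)
  | of_succ k hk ih =>
    rw [funext (hVi k hi hk)]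
    refine hlin.inf ((concaveOn_const (d (k + 1)) (convex_Icc 0 1)).add ?_)
    exact concaveOn_finset_sum (convex_Icc 0 1) _ fun y _ =>
      (ih (by omega)).mixture_mul_posterior (hp1 _ y) (hp0 _ y)
end

section
/- Define the augmented value functions allowing early positive decisions by W_K(π) = V_K(π) = min(C_M·π, C_A·(1−π)) and, for i = K−1,…,1, W_i(π) = min(C_M·π, C_A·(1−π), d_{i+1} + ∑_{y∈𝒴_{i+1}} m_{i+1}(y,π)·W_{i+1}(u_{i+1}(y,π))). If for every intermediate stage i = 1,…,K−1 and every π ∈ [0,1] the original value functions satisfy V_i(π) ≤ C_A·(1−π), then W_i(π) = V_i(π) for all i = 1,…,K and all π ∈ [0,1]; that is, introducing early positive decisions does not improve the performance of the cascade. (Proposition 1 of the paper.) -/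
/-- The posterior probability of a binary hypothesis with prior `π` and positive likelihoods
`a`, `b` lies in the unit interval. -/
theorem posterior_mem_Icc_s11 {a b π : ℝ} (ha : 0 < a) (hb : 0 < b) (hπ : π ∈ Set.Icc (0 : ℝ) 1) :
    π * a / (π * a + (1 - π) * b) ∈ Set.Icc (0 : ℝ) 1 := by
  have h₁ : 0 ≤ π * a := mul_nonneg hπ.1 ha.le
  have h₀ : 0 ≤ (1 - π) * b := mul_nonneg (sub_nonneg.2 hπ.2) hb.le
  exact ⟨by positivity, div_le_one_of_le₀ (by linarith) (by linarith)⟩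

/-- Proposition 1 of the paper: if at every intermediate stage the original
value functions satisfy `V i π ≤ C_A·(1−π)` on `[0,1]`, then the augmented value functions
`W` allowing early positive decisions coincide with `V` on `[0,1]` for all stages; i.e.,
introducing early positive decisions does not improve the performance of the cascade. -/
theorem stmt11 (K : ℕ) (hK : 1 ≤ K)
    (𝒴 : ℕ → Type) [∀ i, Fintype (𝒴 i)] [∀ i, Nonempty (𝒴 i)]
    (p1 p0 : ∀ i, 𝒴 i → ℝ)
    (hp1 : ∀ i y, 0 < p1 i y) (hp0 : ∀ i y, 0 < p0 i y)
    (hs1 : ∀ i, ∑ y, p1 i y = 1) (hs0 : ∀ i, ∑ y, p0 i y = 1)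
    (C_M C_A : ℝ) (hCM : 0 ≤ C_M) (hCA : 0 ≤ C_A)
    (d : ℕ → ℝ) (hd : ∀ i, 0 ≤ d i)
    (V W : ℕ → ℝ → ℝ)
    (hVK : ∀ π : ℝ, V K π = min (C_M * π) (C_A * (1 - π)))
    (hVi : ∀ i, 1 ≤ i → i < K → ∀ π : ℝ,
      V i π = min (C_M * π) (d (i+1) + ∑ y : 𝒴 (i+1),
        (π * p1 (i+1) y + (1 - π) * p0 (i+1) y) *
          V (i+1) (π * p1 (i+1) y / (π * p1 (i+1) y + (1 - π) * p0 (i+1) y))))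
    (hWK : ∀ π : ℝ, W K π = min (C_M * π) (C_A * (1 - π)))
    (hWi : ∀ i, 1 ≤ i → i < K → ∀ π : ℝ,
      W i π = min (C_M * π) (min (C_A * (1 - π))
        (d (i+1) + ∑ y : 𝒴 (i+1),
          (π * p1 (i+1) y + (1 - π) * p0 (i+1) y) *
            W (i+1) (π * p1 (i+1) y / (π * p1 (i+1) y + (1 - π) * p0 (i+1) y)))))
    (hdom : ∀ i, 1 ≤ i → i < K → ∀ π ∈ Set.Icc (0:ℝ) 1, V i π ≤ C_A * (1 - π)) :
    ∀ i, 1 ≤ i → i ≤ K → ∀ π ∈ Set.Icc (0:ℝ) 1, W i π = V i π := by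
  intro i hi hiK
  induction hiK using Nat.decreasingInduction with
  | self => exact fun π _ => (hWK π).trans (hVK π).symm
  | of_succ i hiK ih =>
    intro π hπ
    have hV := hdom i hi hiK π hπ
    rw [hVi i hi hiK] at hV
    rw [hWi i hi hiK, hVi i hi hiK, Finset.sum_congr rfl fun y _ => by
      rw [ih (by omega) _ (posterior_mem_Icc_s11 (hp1 (i + 1) y) (hp0 (i + 1) y) hπ)]]
    rw [min_left_comm, min_eq_right hV]
end

section
/- The minimum of R(δ) over all (finitely many) deterministic history-dependent policies δ equals V₀(π₀) = d₁ + ∑_{y∈𝒴₁} m₁(y,π₀)·V₁(u₁(y,π₀)), where V₁,…,V_K are given by the backward value recursion; in particular the minimum is attained by some policy. (The dynamic-programming optimality underlying Theorem 1 and Corollary 1 for the primary application: the optimal risk of the K-stage cascade equals the value of the backward recursion at the prior.) -/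
/-- The first stage in `{1, …, K - 1}` at which the decision sequence `s` is `false`, or `K`. -/
def stopTime (K : ℕ) (s : ℕ → Bool) : ℕ :=
  if h : ((Finset.Ico 1 K).filter (fun i => s i = false)).Nonempty
  then ((Finset.Ico 1 K).filter (fun i => s i = false)).min' h
  else K

/-- The cost of a path with decision sequence `s` and class label `x`. -/
noncomputable def pathCost (C_M C_A : ℝ) (K : ℕ) (d : ℕ → ℝ) (s : ℕ → Bool) (x : Bool) : ℝ :=
  (∑ i ∈ Finset.Icc 1 (stopTime K s), d i) +
    (if x = true ∧ (stopTime K s < K ∨ s K = false) then C_M else 0) +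
    (if x = false ∧ stopTime K s = K ∧ s K = true then C_A else 0)

/-- The expectation of `f` under the product of the first `K` weights `p 1, …, p K`. -/
noncomputable def productMean (K : ℕ) (𝒴 : ℕ → Type) [∀ i, Fintype (𝒴 i)]
    (p : ∀ i, 𝒴 i → ℝ) (f : (∀ j : Fin K, 𝒴 (j.val + 1)) → ℝ) : ℝ :=
  ∑ y : (∀ j : Fin K, 𝒴 (j.val + 1)), (∏ j : Fin K, p (j.val + 1) (y j)) * f y

/-- The decision at stage `i` depends only on the first `i` coordinates. -/
def IsHistoryDependent {K : ℕ} {𝒴 : ℕ → Type}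
    (δ : ℕ → (∀ j : Fin K, 𝒴 (j.val + 1)) → Bool) : Prop :=
  ∀ i : ℕ, ∀ y y' : (∀ j : Fin K, 𝒴 (j.val + 1)),
    (∀ j : Fin K, (j : ℕ) < i → y j = y' j) → δ i y = δ i y'

/-- The cost of the policy `δ` when the two classes carry the weights `a` and `b`. -/
noncomputable def weightedRisk (C_M C_A : ℝ) (K : ℕ) (𝒴 : ℕ → Type) [∀ i, Fintype (𝒴 i)]
    (p1 p0 : ∀ i, 𝒴 i → ℝ) (d : ℕ → ℝ) (a b : ℝ)
    (δ : ℕ → (∀ j : Fin K, 𝒴 (j.val + 1)) → Bool) : ℝ :=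
  a * productMean K 𝒴 p1 (fun y => pathCost C_M C_A K d (fun i => δ i y) true) +
    b * productMean K 𝒴 p0 (fun y => pathCost C_M C_A K d (fun i => δ i y) false)

lemma stopTime_one (s : ℕ → Bool) : stopTime 1 s = 1 := by
  simp [stopTime]

lemma stopTime_eq_one {n : ℕ} {s : ℕ → Bool} (h : s 1 = false) : stopTime (n + 2) s = 1 := by
  have hm : 1 ∈ (Finset.Ico 1 (n + 2)).filter (fun i => s i = false) := by simp [h]
  have hne : ((Finset.Ico 1 (n + 2)).filter (fun i => s i = false)).Nonempty := ⟨1, hm⟩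
  rw [stopTime, dif_pos hne]
  refine le_antisymm (Finset.min'_le _ _ hm) (Finset.le_min' _ _ _ fun i hi => ?_)
  simp only [Finset.mem_filter, Finset.mem_Ico] at hi
  exact hi.1.1

lemma filter_Ico_succ {n : ℕ} {s : ℕ → Bool} (h : s 1 = true) :
    (Finset.Ico 1 (n + 2)).filter (fun i => s i = false) =
      ((Finset.Ico 1 (n + 1)).filter (fun i => s (i + 1) = false)).image (· + 1) := by
  ext i
  simp only [Finset.mem_filter, Finset.mem_Ico, Finset.mem_image]
  constructor
  · rintro ⟨⟨h1, h2⟩, h3⟩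
    have : i ≠ 1 := by rintro rfl; simp [h] at h3
    obtain ⟨k, rfl⟩ : ∃ k, i = k + 1 := ⟨i - 1, by omega⟩
    exact ⟨k, ⟨⟨by omega, by omega⟩, h3⟩, rfl⟩
  · rintro ⟨k, ⟨⟨h1, h2⟩, h3⟩, rfl⟩
    exact ⟨⟨by omega, by omega⟩, h3⟩

lemma stopTime_succ {n : ℕ} {s : ℕ → Bool} (h : s 1 = true) :
    stopTime (n + 2) s = stopTime (n + 1) (fun i => s (i + 1)) + 1 := by
  unfold stopTime
  simp only [filter_Ico_succ h, Finset.image_nonempty]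
  split_ifs with hne
  · exact Finset.min'_image (fun _ _ hij => Nat.succ_le_succ hij) _ _
  · rfl

lemma pathCost_one (C_M C_A : ℝ) (d : ℕ → ℝ) (s : ℕ → Bool) (x : Bool) :
    pathCost C_M C_A 1 d s x =
      d 1 + bif s 1 then (bif x then 0 else C_A) else (bif x then C_M else 0) := by
  cases x <;> cases h : s 1 <;> simp [pathCost, stopTime_one, h]

lemma pathCost_of_false (C_M C_A : ℝ) {n : ℕ} (d : ℕ → ℝ) {s : ℕ → Bool} (x : Bool)
    (h : s 1 = false) :
    pathCost C_M C_A (n + 2) d s x = d 1 + bif x then C_M else 0 := by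
  cases x <;> simp [pathCost, stopTime_eq_one h]

lemma pathCost_of_true (C_M C_A : ℝ) {n : ℕ} (d : ℕ → ℝ) {s : ℕ → Bool} (x : Bool)
    (h : s 1 = true) :
    pathCost C_M C_A (n + 2) d s x =
      d 1 + pathCost C_M C_A (n + 1) (fun i => d (i + 1)) (fun i => s (i + 1)) x := by
  have hsum : ∀ T, ∑ i ∈ Finset.Icc 1 (T + 1), d i = d 1 + ∑ i ∈ Finset.Icc 1 T, d (i + 1) := by
    intro T
    induction T with
    | zero => simp
    | succ T ih =>
      rw [Finset.sum_Icc_succ_top (by omega), ih, Finset.sum_Icc_succ_top (by omega), add_assoc]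
  simp only [pathCost, stopTime_succ h, hsum, Nat.add_lt_add_iff_right, Nat.add_right_cancel_iff,
    show n + 2 = n + 1 + 1 from rfl]
  ring

lemma pathCost_congr (C_M C_A : ℝ) {n : ℕ} (d : ℕ → ℝ) {s t : ℕ → Bool} (x : Bool)
    (h : ∀ i, 1 ≤ i → s i = t i) :
    pathCost C_M C_A (n + 1) d s x = pathCost C_M C_A (n + 1) d t x := by
  have hf : (Finset.Ico 1 (n + 1)).filter (fun i => s i = false) =
      (Finset.Ico 1 (n + 1)).filter (fun i => t i = false) :=
    Finset.filter_congr fun i hi => by rw [h i (Finset.mem_Ico.1 hi).1]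
  have hT : stopTime (n + 1) s = stopTime (n + 1) t := by simp only [stopTime, hf]
  simp only [pathCost, hT, h (n + 1) (by omega)]

lemma weightedRisk_congr (C_M C_A : ℝ) {n : ℕ} {𝒴 : ℕ → Type} [∀ i, Fintype (𝒴 i)]
    (p1 p0 : ∀ i, 𝒴 i → ℝ) (d : ℕ → ℝ) (a b : ℝ)
    {δ ε : ℕ → (∀ j : Fin (n + 1), 𝒴 (j.val + 1)) → Bool}
    (h : ∀ i, 1 ≤ i → ∀ y, δ i y = ε i y) :
    weightedRisk C_M C_A (n + 1) 𝒴 p1 p0 d a b δ =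
      weightedRisk C_M C_A (n + 1) 𝒴 p1 p0 d a b ε := by
  have hc : ∀ x y, pathCost C_M C_A (n + 1) d (fun i => δ i y) x =
      pathCost C_M C_A (n + 1) d (fun i => ε i y) x :=
    fun x y => pathCost_congr _ _ _ _ fun i hi => h i hi y
  simp only [weightedRisk, hc]

lemma productMean_succ (n : ℕ) (𝒴 : ℕ → Type) [∀ i, Fintype (𝒴 i)]
    (p : ∀ i, 𝒴 i → ℝ) (f : (∀ j : Fin (n + 1), 𝒴 (j.val + 1)) → ℝ) :
    productMean (n + 1) 𝒴 p f = ∑ z : 𝒴 1, p 1 z *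
      productMean n (fun i => 𝒴 (i + 1)) (fun i => p (i + 1))
        (fun y => f (Fin.cons (α := fun j : Fin (n + 1) => 𝒴 (j.val + 1)) z y)) := by
  unfold productMean
  rw [← (Fin.consEquiv (fun j : Fin (n + 1) => 𝒴 (j.val + 1))).sum_comp, Fintype.sum_prod_type]
  refine Finset.sum_congr rfl fun z _ => ?_
  rw [Finset.mul_sum]
  refine Finset.sum_congr rfl fun y _ => ?_
  rw [Fin.prod_univ_succ, ← mul_assoc]
  rfl

lemma productMean_const (n : ℕ) (𝒴 : ℕ → Type) [∀ i, Fintype (𝒴 i)]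
    (p : ∀ i, 𝒴 i → ℝ) (hs : ∀ i, ∑ y, p i y = 1) (c : ℝ) :
    productMean n 𝒴 p (fun _ => c) = c := by
  induction n generalizing 𝒴 with
  | zero => simp [productMean]
  | succ n ih =>
    rw [productMean_succ]
    simp only [ih (fun i => 𝒴 (i + 1)) (fun i => p (i + 1)) (fun i => hs (i + 1))]
    rw [← Finset.sum_mul, hs, one_mul]

lemma productMean_const_add (n : ℕ) (𝒴 : ℕ → Type) [∀ i, Fintype (𝒴 i)]
    (p : ∀ i, 𝒴 i → ℝ) (hs : ∀ i, ∑ y, p i y = 1) (c : ℝ)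
    (f : (∀ j : Fin n, 𝒴 (j.val + 1)) → ℝ) :
    productMean n 𝒴 p (fun y => c + f y) = c + productMean n 𝒴 p f := by
  conv_rhs => rw [← productMean_const n 𝒴 p hs c]
  simp only [productMean, mul_add, Finset.sum_add_distrib]

lemma weightedRisk_one (C_M C_A : ℝ) (𝒴 : ℕ → Type) [∀ i, Fintype (𝒴 i)]
    (p1 p0 : ∀ i, 𝒴 i → ℝ) (hs1 : ∀ i, ∑ y, p1 i y = 1) (hs0 : ∀ i, ∑ y, p0 i y = 1)
    (d : ℕ → ℝ) (a b : ℝ) (δ : ℕ → (∀ j : Fin 1, 𝒴 (j.val + 1)) → Bool) :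
    weightedRisk C_M C_A 1 𝒴 p1 p0 d a b δ = d 1 * (a + b) + ∑ z : 𝒴 1,
      bif δ 1 (Fin.cons (α := fun j : Fin 1 => 𝒴 (j.val + 1)) z finZeroElim)
      then C_A * (b * p0 1 z) else C_M * (a * p1 1 z) := by
  simp only [weightedRisk, pathCost_one, productMean_const_add _ _ _ hs1,
    productMean_const_add _ _ _ hs0, productMean_succ 0]
  rw [mul_add, mul_add, Finset.mul_sum, Finset.mul_sum, add_add_add_comm,
    ← Finset.sum_add_distrib]
  congr 1
  · ring
  · refine Finset.sum_congr rfl fun z _ => ?_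
    simp only [productMean, Finset.univ_unique, Finset.sum_singleton, Finset.univ_eq_empty,
      Finset.prod_empty, one_mul]
    rw [Subsingleton.elim (default : ∀ j : Fin 0, 𝒴 (j.val + 1 + 1)) finZeroElim]
    cases δ 1 (Fin.cons (α := fun j : Fin 1 => 𝒴 (j.val + 1)) z finZeroElim) <;> simp <;> ring

/-- The continuation of the policy `δ` after the first observation `z`. -/
def tailPolicy {n : ℕ} {𝒴 : ℕ → Type} (δ : ℕ → (∀ j : Fin (n + 1), 𝒴 (j.val + 1)) → Bool)
    (z : 𝒴 1) : ℕ → (∀ j : Fin n, 𝒴 (j.val + 1 + 1)) → Bool :=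
  fun i y => δ (i + 1) (Fin.cons (α := fun j : Fin (n + 1) => 𝒴 (j.val + 1)) z y)

lemma IsHistoryDependent.tailPolicy {n : ℕ} {𝒴 : ℕ → Type}
    {δ : ℕ → (∀ j : Fin (n + 1), 𝒴 (j.val + 1)) → Bool} (hδ : IsHistoryDependent δ) (z : 𝒴 1) :
    IsHistoryDependent (𝒴 := fun i => 𝒴 (i + 1)) (tailPolicy δ z) := by
  intro i y y' h
  refine hδ _ _ _ fun j => ?_
  refine Fin.cases (fun _ => rfl) (fun k hk => ?_) j
  exact h k (by simpa using hk)

lemma weightedRisk_succ (C_M C_A : ℝ) (n : ℕ) (𝒴 : ℕ → Type) [∀ i, Fintype (𝒴 i)]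
    (p1 p0 : ∀ i, 𝒴 i → ℝ) (hs1 : ∀ i, ∑ y, p1 i y = 1) (hs0 : ∀ i, ∑ y, p0 i y = 1)
    (d : ℕ → ℝ) (a b : ℝ) (δ : ℕ → (∀ j : Fin (n + 2), 𝒴 (j.val + 1)) → Bool)
    (go : 𝒴 1 → Bool)
    (hgo : ∀ z y, δ 1 (Fin.cons (α := fun j : Fin (n + 2) => 𝒴 (j.val + 1)) z y) = go z) :
    weightedRisk C_M C_A (n + 2) 𝒴 p1 p0 d a b δ = d 1 * (a + b) + ∑ z : 𝒴 1,
      bif go z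
      then weightedRisk C_M C_A (n + 1) (fun i => 𝒴 (i + 1)) (fun i => p1 (i + 1))
        (fun i => p0 (i + 1)) (fun i => d (i + 1)) (a * p1 1 z) (b * p0 1 z) (tailPolicy δ z)
      else C_M * (a * p1 1 z) := by
  have hsplit : d 1 * (a + b) = ∑ z : 𝒴 1, d 1 * (a * p1 1 z + b * p0 1 z) := by
    rw [← Finset.mul_sum, Finset.sum_add_distrib, ← Finset.mul_sum, ← Finset.mul_sum, hs1, hs0,
      mul_one, mul_one]
  rw [hsplit, ← Finset.sum_add_distrib]
  simp only [weightedRisk, productMean_succ (n + 1)]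
  rw [Finset.mul_sum, Finset.mul_sum, ← Finset.sum_add_distrib]
  refine Finset.sum_congr rfl fun z _ => ?_
  cases h : go z
  · simp only [fun y x => pathCost_of_false C_M C_A d (n := n) (s := fun i =>
      δ i (Fin.cons (α := fun j : Fin (n + 2) => 𝒴 (j.val + 1)) z y)) x ((hgo z y).trans h)]
    rw [productMean_const _ _ _ fun i => hs1 (i + 1), productMean_const _ _ _ fun i => hs0 (i + 1)]
    simp only [cond_true, cond_false]
    ring
  · simp only [fun y x => pathCost_of_true C_M C_A d (n := n) (s := fun i =>
      δ i (Fin.cons (α := fun j : Fin (n + 2) => 𝒴 (j.val + 1)) z y)) x ((hgo z y).trans h)]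
    rw [productMean_const_add _ _ _ fun i => hs1 (i + 1),
      productMean_const_add _ _ _ fun i => hs0 (i + 1)]
    simp only [cond_true, tailPolicy]
    ring

/-- Dynamic programming for unnormalised class weights. -/
theorem isLeast_weightedRisk (C_M C_A : ℝ) (n : ℕ) (𝒴 : ℕ → Type) [∀ i, Fintype (𝒴 i)]
    [∀ i, Nonempty (𝒴 i)] (p1 p0 : ∀ i, 𝒴 i → ℝ)
    (hp1 : ∀ i y, 0 < p1 i y) (hp0 : ∀ i y, 0 < p0 i y)
    (hs1 : ∀ i, ∑ y, p1 i y = 1) (hs0 : ∀ i, ∑ y, p0 i y = 1)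
    (d : ℕ → ℝ) (W : ℕ → ℝ → ℝ → ℝ)
    (hWK : ∀ a b : ℝ, 0 ≤ a → 0 ≤ b → 0 < a + b → W (n + 1) a b = min (C_M * a) (C_A * b))
    (hWi : ∀ i, 1 ≤ i → i < n + 1 → ∀ a b : ℝ, 0 ≤ a → 0 ≤ b → 0 < a + b →
      W i a b = min (C_M * a) (d (i + 1) * (a + b) + ∑ y : 𝒴 (i + 1),
        W (i + 1) (a * p1 (i + 1) y) (b * p0 (i + 1) y)))
    (a b : ℝ) (ha : 0 ≤ a) (hb : 0 ≤ b) (hab : 0 < a + b) :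
    IsLeast {r | ∃ δ : ℕ → (∀ j : Fin (n + 1), 𝒴 (j.val + 1)) → Bool,
        IsHistoryDependent δ ∧ r = weightedRisk C_M C_A (n + 1) 𝒴 p1 p0 d a b δ}
      (d 1 * (a + b) + ∑ y : 𝒴 1, W 1 (a * p1 1 y) (b * p0 1 y)) := by
  have hpos : ∀ z : 𝒴 1, 0 ≤ a * p1 1 z ∧ 0 ≤ b * p0 1 z ∧ 0 < a * p1 1 z + b * p0 1 z := by
    intro z
    have h1 := hp1 1 z
    have h0 := hp0 1 z
    refine ⟨by positivity, by positivity, ?_⟩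
    rcases ha.lt_or_eq with h | h
    · positivity
    · have : 0 < b := by linarith
      positivity
  induction n generalizing 𝒴 d W a b with
  | zero =>
    have hW : ∀ z : 𝒴 1, W 1 (a * p1 1 z) (b * p0 1 z) =
        min (C_M * (a * p1 1 z)) (C_A * (b * p0 1 z)) :=
      fun z => hWK _ _ (hpos z).1 (hpos z).2.1 (hpos z).2.2
    simp only [hW]
    constructor
    · refine ⟨fun i y => match i with
        | 0 => true
        | _ + 1 => decide (C_A * (b * p0 1 (y 0)) ≤ C_M * (a * p1 1 (y 0))), ?_, ?_⟩
      · rintro (_ | i) y y' h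
        · rfl
        · simp only [h 0 (Nat.succ_pos i)]
      · rw [weightedRisk_one _ _ _ _ _ hs1 hs0]
        congr 1
        refine Finset.sum_congr rfl fun z _ => ?_
        simp only [Fin.cons_zero]
        rcases le_or_gt (C_A * (b * p0 1 z)) (C_M * (a * p1 1 z)) with h | h
        · rw [min_eq_right h, decide_eq_true h, cond_true]
        · rw [min_eq_left h.le, decide_eq_false h.not_ge, cond_false]
    · rintro r ⟨δ, -, rfl⟩
      rw [weightedRisk_one _ _ _ _ _ hs1 hs0]
      gcongr with z
      cases δ 1 (Fin.cons (α := fun j : Fin 1 => 𝒴 (j.val + 1)) z finZeroElim)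
      · exact min_le_left _ _
      · exact min_le_right _ _
  | succ n ih =>
    set v : 𝒴 1 → ℝ := fun z => d 2 * (a * p1 1 z + b * p0 1 z) +
      ∑ y : 𝒴 2, W 2 (a * p1 1 z * p1 2 y) (b * p0 1 z * p0 2 y)
    have hW : ∀ z : 𝒴 1, W 1 (a * p1 1 z) (b * p0 1 z) = min (C_M * (a * p1 1 z)) (v z) :=
      fun z => hWi 1 le_rfl (by omega) _ _ (hpos z).1 (hpos z).2.1 (hpos z).2.2
    have key : ∀ z : 𝒴 1, IsLeast {r | ∃ δ : ℕ → (∀ j : Fin (n + 1), 𝒴 (j.val + 1 + 1)) → Bool,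
        IsHistoryDependent (𝒴 := fun i => 𝒴 (i + 1)) δ ∧
          r = weightedRisk C_M C_A (n + 1) (fun i => 𝒴 (i + 1)) (fun i => p1 (i + 1))
            (fun i => p0 (i + 1)) (fun i => d (i + 1)) (a * p1 1 z) (b * p0 1 z) δ} (v z) := by
      intro z
      obtain ⟨h1, h0, h10⟩ := hpos z
      refine ih (fun i => 𝒴 (i + 1)) (fun i => p1 (i + 1)) (fun i => p0 (i + 1))
        (fun i => hp1 (i + 1)) (fun i => hp0 (i + 1)) (fun i => hs1 (i + 1))
        (fun i => hs0 (i + 1)) (fun i => d (i + 1)) (fun i => W (i + 1)) hWK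
        (fun i hi hin => hWi (i + 1) (by omega) (by omega)) _ _ h1 h0 h10 fun y => ?_
      have hq1 := hp1 2 y
      have hq0 := hp0 2 y
      refine ⟨by positivity, by positivity, ?_⟩
      rcases h1.lt_or_eq with h | h
      · positivity
      · have : 0 < b * p0 1 z := by linarith
        positivity
    simp only [hW]
    constructor
    · choose δ' hδ' hr using fun z => (key z).1
      let δ : ℕ → (∀ j : Fin (n + 2), 𝒴 (j.val + 1)) → Bool := fun i y => match i with
        | 0 => true
        | 1 => decide (v (y 0) ≤ C_M * (a * p1 1 (y 0)))
        | i + 2 => δ' (y 0) (i + 1) (fun j => y j.succ)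
      refine ⟨δ, ?_, ?_⟩
      · rintro (_ | _ | i) y y' h
        · rfl
        · simp only [δ, h 0 Nat.one_pos]
        · have h0 : y 0 = y' 0 := h 0 (Nat.succ_pos _)
          simp only [δ, h0]
          exact hδ' _ _ _ _ fun j hj => h j.succ (by simpa using hj)
      · rw [weightedRisk_succ _ _ _ _ _ _ hs1 hs0 _ _ _ _
          (fun z => decide (v z ≤ C_M * (a * p1 1 z))) (fun z y => rfl)]
        congr 1
        refine Finset.sum_congr rfl fun z _ => ?_
        rcases le_or_gt (v z) (C_M * (a * p1 1 z)) with h | h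
        · rw [min_eq_right h, decide_eq_true h, cond_true, hr z]
          refine weightedRisk_congr _ _ (𝒴 := fun i => 𝒴 (i + 1)) _ _ _ _ _ fun i hi y => ?_
          obtain ⟨k, rfl⟩ : ∃ k, i = k + 1 := ⟨i - 1, by omega⟩
          rfl
        · rw [min_eq_left h.le, decide_eq_false h.not_ge, cond_false]
    · rintro r ⟨δ, hδ, rfl⟩
      rw [weightedRisk_succ _ _ _ _ _ _ hs1 hs0 _ _ _ _
        (fun z => δ 1 (Fin.cons (α := fun j : Fin (n + 2) => 𝒴 (j.val + 1)) z
          fun _ => Classical.arbitrary _))]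
      · gcongr with z
        cases δ 1 (Fin.cons (α := fun j : Fin (n + 2) => 𝒴 (j.val + 1)) z
          fun _ => Classical.arbitrary _)
        · exact min_le_left _ _
        · exact (min_le_right _ _).trans ((key z).2 ⟨_, hδ.tailPolicy z, rfl⟩)
      · intro z y
        refine hδ _ _ _ fun j hj => ?_
        obtain rfl : j = 0 := Fin.ext (by simpa using hj)
        rfl


/-- dynamic-programming optimality underlying Theorem 1 / Corollary 1 for the
primary application: the minimum of the risk `R δ` over all deterministic history-dependent
policies `δ` equals `V₀(π₀) = d₁ + ∑ y, m₁(y,π₀)·V₁(u₁(y,π₀))`, where `V₁,…,V_K` are given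
by the backward value recursion (Eq. (12)); in particular the minimum is attained.
Stage `i ∈ {1,…,K}` corresponds to coordinate `j : Fin K` with `j.val + 1 = i`.
A policy is a family `δ i : (∏ j, 𝒴 j) → Bool` that, for each stage `i`, depends only on
the first `i` feature coordinates; for `i < K`, `δ i y = false` means stop and declare
negative, `δ i y = true` means extract the next feature; `δ K y` is the final declaration.
`T δ y` is the first stage in `{1,…,K−1}` at which the policy stops (or `K`), the path
cost is `∑_{i=1}^{T} dᵢ` plus `C_M` for a missed target and `C_A` for a false alarm, and
the risk `R δ` is the expectation of the path cost under the joint pmf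
`P(x,y) = (π₀ if x else 1−π₀)·∏ⱼ pⱼ(yⱼ|x)`. -/
theorem stmt18 (K : ℕ) (hK : 1 ≤ K)
    (𝒴 : ℕ → Type) [∀ i, Fintype (𝒴 i)] [∀ i, Nonempty (𝒴 i)]
    (π₀ : ℝ) (hπ₀ : π₀ ∈ Set.Icc (0:ℝ) 1)
    (C_M C_A : ℝ) (hCM : 0 ≤ C_M) (hCA : 0 ≤ C_A)
    (d : ℕ → ℝ) (hd : ∀ i, 0 ≤ d i)
    (p1 p0 : ∀ i, 𝒴 i → ℝ)
    (hp1 : ∀ i y, 0 < p1 i y) (hp0 : ∀ i y, 0 < p0 i y)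
    (hs1 : ∀ i, ∑ y, p1 i y = 1) (hs0 : ∀ i, ∑ y, p0 i y = 1)
    (V : ℕ → ℝ → ℝ)
    (hVK : ∀ π : ℝ, V K π = min (C_M * π) (C_A * (1 - π)))
    (hVi : ∀ i, 1 ≤ i → i < K → ∀ π : ℝ,
      V i π = min (C_M * π) (d (i+1) + ∑ y : 𝒴 (i+1),
        (π * p1 (i+1) y + (1 - π) * p0 (i+1) y) *
          V (i+1) (π * p1 (i+1) y / (π * p1 (i+1) y + (1 - π) * p0 (i+1) y)))) :
    IsLeast
      { r : ℝ |
        ∃ δ : ℕ → ((∀ j : Fin K, 𝒴 (j.val + 1)) → Bool),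
          -- history-dependence: the decision at stage `i` depends only on `y₁,…,yᵢ`
          (∀ i : ℕ, ∀ y y' : (∀ j : Fin K, 𝒴 (j.val + 1)),
              (∀ j : Fin K, (j : ℕ) < i → y j = y' j) → δ i y = δ i y') ∧
          r = ∑ x : Bool, ∑ y : (∀ j : Fin K, 𝒴 (j.val + 1)),
              ((if x then π₀ else 1 - π₀) *
                ∏ j : Fin K, (if x then p1 (j.val + 1) (y j) else p0 (j.val + 1) (y j))) *
              ((∑ i ∈ Finset.Icc 1
                  (if h : ((Finset.Ico 1 K).filter (fun i => δ i y = false)).Nonempty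
                   then ((Finset.Ico 1 K).filter (fun i => δ i y = false)).min' h
                   else K), d i) +
               (if x = true ∧
                  ((if h : ((Finset.Ico 1 K).filter (fun i => δ i y = false)).Nonempty
                    then ((Finset.Ico 1 K).filter (fun i => δ i y = false)).min' h
                    else K) < K ∨ δ K y = false)
                then C_M else 0) +
               (if x = false ∧
                  (if h : ((Finset.Ico 1 K).filter (fun i => δ i y = false)).Nonempty
                   then ((Finset.Ico 1 K).filter (fun i => δ i y = false)).min' h
                   else K) = K ∧ δ K y = true
                then C_A else 0)) }
      (d 1 + ∑ y : 𝒴 1, (π₀ * p1 1 y + (1 - π₀) * p0 1 y) *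
        V 1 (π₀ * p1 1 y / (π₀ * p1 1 y + (1 - π₀) * p0 1 y))) := by
  obtain ⟨n, rfl⟩ : ∃ n, K = n + 1 := ⟨K - 1, by omega⟩
  have key := isLeast_weightedRisk C_M C_A n 𝒴 p1 p0 hp1 hp0 hs1 hs0 d
    (fun i a b => (a + b) * V i (a / (a + b))) ?_ ?_ π₀ (1 - π₀) hπ₀.1 (by linarith [hπ₀.2])
    (by linarith)
  · rw [add_sub_cancel, mul_one] at key
    convert key using 4 with r
    ext δ
    refine and_congr Iff.rfl ?_
    rw [Fintype.sum_bool]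
    conv_rhs => simp only [weightedRisk, productMean, Finset.mul_sum, ← mul_assoc]
    rfl
  · intro a b ha hb hab
    simp only [hVK]
    rw [mul_min_of_nonneg _ _ hab.le]
    congr 1 <;> field_simp
    ring
  · intro i hi hin a b ha hb hab
    simp only [hVi i hi hin]
    rw [mul_min_of_nonneg _ _ hab.le, mul_add, Finset.mul_sum]
    congr 1
    · field_simp
    · congr 1
      · ring
      · refine Finset.sum_congr rfl fun y _ => ?_
        have hm : a / (a + b) * p1 (i + 1) y + (1 - a / (a + b)) * p0 (i + 1) y =
            (a * p1 (i + 1) y + b * p0 (i + 1) y) / (a + b) := by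
          field_simp
          ring
        rw [hm, ← mul_assoc, mul_div_cancel₀ _ hab.ne', div_mul_eq_mul_div,
          div_div_div_cancel_right₀ hab.ne']
end
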